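/- arXiv:2109.14351 — 9 statements merged into one kernel-verified Lean document; each statement's English description precedes it below -/
import Mathlib

section
/- Let a, b, c be nonnegative reals with a² + b² + c² = 1 and (a,b) ≠ (0,0). In ℂ³ with standard basis e₁, e₂, e₃, set w = (a,b,c) and let U = (I − 2 e₃ e₃*)(I − 2 w w*) be the product of the two Householder reflections about e₃ and w. Then U is unitary and its spectrum (eigenvalue multiset as a set) is {1, e^{iλ}, e^{−iλ}}, where λ = 2 arccos c. -/
open Matrix

/-- The Householder reflection `I − 2 v v*` about a vector `v ∈ ℂ³`. -/
noncomputable def householder (v : Fin 3 → ℂ) : Matrix (Fin 3) (Fin 3) ℂ :=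
  1 - (2 : ℂ) • Matrix.vecMulVec v (star v)

/-- with `a, b, c ≥ 0`, `a² + b² + c² = 1`, `(a,b) ≠ (0,0)`,
`w = (a,b,c)` and `U = (I − 2 e₃ e₃*)(I − 2 w w*)`, the operator `U` is unitary and
its spectrum is `{1, e^{iλ}, e^{−iλ}}` where `λ = 2 arccos c`. -/
theorem stmt_2 (a b c : ℝ) (ha : 0 ≤ a) (hb : 0 ≤ b) (hc : 0 ≤ c)
    (hsum : a ^ 2 + b ^ 2 + c ^ 2 = 1) (hab : ¬(a = 0 ∧ b = 0)) :
    householder ![0, 0, 1] * householder ![(a : ℂ), (b : ℂ), (c : ℂ)] ∈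
        Matrix.unitaryGroup (Fin 3) ℂ ∧
      spectrum ℂ (householder ![0, 0, 1] * householder ![(a : ℂ), (b : ℂ), (c : ℂ)]) =
        {1, Complex.exp (Complex.I * (2 * Real.arccos c)),
          Complex.exp (-(Complex.I * (2 * Real.arccos c)))} := by
  have hC : (a : ℂ) ^ 2 + (b : ℂ) ^ 2 + (c : ℂ) ^ 2 = 1 := by exact_mod_cast hsum
  have h2 : (starRingEnd ℂ) 2 = 2 := Complex.conj_ofNat 2
  have hh : ∀ (v : Fin 3 → ℂ) (i j : Fin 3), householder v i j =
      (if i = j then 1 else 0) - 2 * (v i * star (v j)) := by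
    intro v i j
    rw [householder, Matrix.sub_apply, Matrix.smul_apply, Matrix.vecMulVec_apply,
      Matrix.one_apply, smul_eq_mul, Pi.star_apply]
  have hU : householder ![0, 0, 1] * householder ![(a : ℂ), (b : ℂ), (c : ℂ)] =
      !![1 - 2 * (a : ℂ) ^ 2, -2 * (a : ℂ) * b, -2 * (a : ℂ) * c;
         -2 * (a : ℂ) * b, 1 - 2 * (b : ℂ) ^ 2, -2 * (b : ℂ) * c;
         2 * (a : ℂ) * c, 2 * (b : ℂ) * c, 2 * (c : ℂ) ^ 2 - 1] := by
    ext i j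
    fin_cases i <;> fin_cases j <;>
      simp [hh, Matrix.mul_apply, Fin.sum_univ_three] <;> ring
  rw [hU]
  constructor
  · rw [Matrix.mem_unitaryGroup_iff]
    ext i j
    fin_cases i <;> fin_cases j <;>
      simp [Matrix.mul_apply, Fin.sum_univ_three, Matrix.star_apply, Matrix.one_apply, h2] <;>
      clear hU hh h2 ha hb hc hab hsum <;> grind
  · have hc1 : c ≤ 1 := by nlinarith [sq_nonneg a, sq_nonneg b]
    have hcos : Real.cos (2 * Real.arccos c) = 2 * c ^ 2 - 1 := by
      rw [Real.cos_two_mul, Real.cos_arccos (by linarith) hc1]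
    have hs : Complex.exp (Complex.I * (2 * Real.arccos c)) +
        Complex.exp (-(Complex.I * (2 * Real.arccos c))) = 2 * (2 * (c : ℂ) ^ 2 - 1) := by
      have h2 : Complex.cos (2 * Real.arccos c) = 2 * (c : ℂ) ^ 2 - 1 := by
        exact_mod_cast congrArg (fun x : ℝ => (x : ℂ)) hcos
      rw [← h2, Complex.two_cos]
      congr 2 <;> ring
    have hp : Complex.exp (Complex.I * (2 * Real.arccos c)) *
        Complex.exp (-(Complex.I * (2 * Real.arccos c))) = 1 := by
      rw [← Complex.exp_add, add_neg_cancel, Complex.exp_zero]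
    generalize Complex.exp (Complex.I * (2 * Real.arccos c)) = p at *
    generalize Complex.exp (-(Complex.I * (2 * Real.arccos c))) = q at *
    ext z
    rw [spectrum.mem_iff, Matrix.isUnit_iff_isUnit_det, isUnit_iff_ne_zero, not_not]
    have hdet : (algebraMap ℂ (Matrix (Fin 3) (Fin 3) ℂ) z -
        !![1 - 2 * (a : ℂ) ^ 2, -2 * (a : ℂ) * b, -2 * (a : ℂ) * c;
         -2 * (a : ℂ) * b, 1 - 2 * (b : ℂ) ^ 2, -2 * (b : ℂ) * c;
         2 * (a : ℂ) * c, 2 * (b : ℂ) * c, 2 * (c : ℂ) ^ 2 - 1]).det = (z - 1) * ((z - p) * (z - q)) := by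
      have e : (z - p) * (z - q) = z ^ 2 - 2 * (2 * (c : ℂ) ^ 2 - 1) * z + 1 := by
        linear_combination (-z) * hs + hp
      rw [e, Matrix.det_fin_three]
      simp [Matrix.algebraMap_matrix_apply]
      have ha2 : (a : ℂ) ^ 2 = 1 - (b : ℂ) ^ 2 - (c : ℂ) ^ 2 := by linear_combination hC
      ring_nf
      simp only [ha2]
      ring
    rw [hdet]
    simp [sub_eq_zero]
end

section
/- Let a, b, c be nonnegative reals with a² + b² + c² = 1 and (a,b) ≠ (0,0). In ℂ³ set w = (a,b,c), u = (a,b,0)/√(a²+b²), λ = 2 arccos c, and U = (I − 2 e₃ e₃*)(I − 2 w w*). Then: (i) the vector v₀ = (b, −a, 0)/√(a²+b²) satisfies U v₀ = v₀; and (ii) the vectors v± = (e₃ ± i u)/√2 satisfy U v± = e^{±iλ} v±. -/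
open Matrix

/-- with `a, b, c ≥ 0`, `a² + b² + c² = 1`, `(a,b) ≠ (0,0)`,
`w = (a,b,c)`, `u = (a,b,0)/√(a²+b²)`, `λ = 2 arccos c` and
`U = (I − 2 e₃ e₃*)(I − 2 w w*)`:
(i) `v₀ = (b, −a, 0)/√(a²+b²)` satisfies `U v₀ = v₀`; and
(ii) `v± = (e₃ ± i u)/√2` satisfy `U v± = e^{±iλ} v±`. -/
theorem stmt_3 (a b c : ℝ) (ha : 0 ≤ a) (hb : 0 ≤ b) (hc : 0 ≤ c)
    (hsum : a ^ 2 + b ^ 2 + c ^ 2 = 1) (hab : ¬(a = 0 ∧ b = 0)) :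
    letI U : Matrix (Fin 3) (Fin 3) ℂ :=
      householder ![0, 0, 1] * householder ![(a : ℂ), (b : ℂ), (c : ℂ)]
    letI u : Fin 3 → ℂ :=
      ((Real.sqrt (a ^ 2 + b ^ 2) : ℂ))⁻¹ • ![(a : ℂ), (b : ℂ), 0]
    letI e₃ : Fin 3 → ℂ := ![0, 0, 1]
    letI lam : ℝ := 2 * Real.arccos c
    letI v₀ : Fin 3 → ℂ :=
      ((Real.sqrt (a ^ 2 + b ^ 2) : ℂ))⁻¹ • ![(b : ℂ), (-a : ℂ), 0]
    letI vplus : Fin 3 → ℂ := ((Real.sqrt 2 : ℂ))⁻¹ • (e₃ + Complex.I • u)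
    letI vminus : Fin 3 → ℂ := ((Real.sqrt 2 : ℂ))⁻¹ • (e₃ - Complex.I • u)
    U.mulVec v₀ = v₀ ∧
      U.mulVec vplus = Complex.exp (Complex.I * lam) • vplus ∧
      U.mulVec vminus = Complex.exp (-(Complex.I * lam)) • vminus := by
  have hpos : 0 < a ^ 2 + b ^ 2 := by
    rcases not_and_or.mp hab with h | h
    · have := sq_nonneg b
      have : 0 < a ^ 2 := by positivity
      linarith
    · have := sq_nonneg a
      have : 0 < b ^ 2 := by positivity
      linarith
  have hs : Real.sqrt (a ^ 2 + b ^ 2) ≠ 0 := (Real.sqrt_pos.mpr hpos).ne'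
  have hs2 : Real.sqrt (a ^ 2 + b ^ 2) ^ 2 = a ^ 2 + b ^ 2 := Real.sq_sqrt hpos.le
  have hcos : Real.cos (Real.arccos c) = c :=
    Real.cos_arccos (by linarith) (by nlinarith)
  have hsin : Real.sin (Real.arccos c) = Real.sqrt (a ^ 2 + b ^ 2) := by
    rw [Real.sin_arccos]
    congr 1
    linarith
  generalize Real.sqrt (a ^ 2 + b ^ 2) = s at *
  have hE : Complex.exp (Complex.I * ((2 * Real.arccos c : ℝ) : ℂ))
      = ((c : ℂ) + s * Complex.I) ^ 2 := by
    have : Complex.I * ((2 * Real.arccos c : ℝ) : ℂ)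
        = ((2 : ℕ) : ℂ) * ((Real.arccos c : ℂ) * Complex.I) := by
      push_cast
      ring
    rw [this, Complex.exp_nat_mul, Complex.exp_mul_I, ← Complex.ofReal_cos,
      ← Complex.ofReal_sin, hcos, hsin]
  have hE' : Complex.exp (-(Complex.I * ((2 * Real.arccos c : ℝ) : ℂ)))
      = ((c : ℂ) - s * Complex.I) ^ 2 := by
    have : -(Complex.I * ((2 * Real.arccos c : ℝ) : ℂ))
        = ((2 : ℕ) : ℂ) * (((-Real.arccos c : ℝ) : ℂ) * Complex.I) := by
      push_cast
      ring
    rw [this, Complex.exp_nat_mul, Complex.exp_mul_I, ← Complex.ofReal_cos,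
      ← Complex.ofReal_sin, Real.cos_neg, Real.sin_neg, hcos, hsin]
    push_cast
    ring
  have hsC : (s : ℂ) ≠ 0 := by exact_mod_cast hs
  have hs2C : (s : ℂ) ^ 2 = (a : ℂ) ^ 2 + (b : ℂ) ^ 2 := by exact_mod_cast hs2
  have hsumC : (c : ℂ) ^ 2 = 1 - (s : ℂ) ^ 2 := by
    rw [hs2C]
    have : (a : ℂ) ^ 2 + (b : ℂ) ^ 2 + (c : ℂ) ^ 2 = 1 := by exact_mod_cast hsum
    linear_combination this
  have hI : Complex.I ^ 2 = -1 := Complex.I_sq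
  obtain ⟨t, ht⟩ : ∃ t : ℂ, t = (s : ℂ)⁻¹ := ⟨_, rfl⟩
  have hst : (s : ℂ) * t = 1 := by rw [ht]; exact mul_inv_cancel₀ hsC
  have hent : ∀ (v : Fin 3 → ℂ) (i j : Fin 3), householder v i j =
      (if i = j then 1 else 0) - 2 * (v i * star (v j)) := by
    intro v i j
    rw [householder, Matrix.sub_apply, Matrix.smul_apply, Matrix.vecMulVec_apply,
      Matrix.one_apply, smul_eq_mul, Pi.star_apply]
  have hU : ∀ x y z : ℂ, (householder ![0, 0, 1] *
      householder ![(a : ℂ), (b : ℂ), (c : ℂ)]).mulVec ![x, y, z] =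
      ![x - 2 * a * (a * x + b * y + c * z), y - 2 * b * (a * x + b * y + c * z),
        -(z - 2 * c * (a * x + b * y + c * z))] := by
    intro x y z
    rw [← Matrix.mulVec_mulVec]
    ext i
    fin_cases i <;>
      simp [hent, Matrix.mulVec, dotProduct, Fin.sum_univ_three] <;> ring
  rw [hE, hE', ← ht]
  generalize ((Real.sqrt 2 : ℝ) : ℂ)⁻¹ = r
  have h0 : t • ![(b : ℂ), (-a : ℂ), 0] = ![t * b, -(t * a), 0] := by
    ext i; fin_cases i <;> simp
  have hp : (![0, 0, 1] + Complex.I • t • ![(a : ℂ), (b : ℂ), 0] : Fin 3 → ℂ)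
      = ![Complex.I * (t * a), Complex.I * (t * b), 1] := by
    ext i; fin_cases i <;> simp
  have hm : (![0, 0, 1] - Complex.I • t • ![(a : ℂ), (b : ℂ), 0] : Fin 3 → ℂ)
      = ![-(Complex.I * (t * a)), -(Complex.I * (t * b)), 1] := by
    ext i; fin_cases i <;> simp
  have hd : (a : ℂ) * (t * a) + b * (t * b) = s := by
    linear_combination (-t) * hs2C + s * hst
  have hdp : (a : ℂ) * (Complex.I * (t * a)) + b * (Complex.I * (t * b)) + c * 1
      = c + s * Complex.I := by linear_combination Complex.I * hd
  have hdm : (a : ℂ) * (-(Complex.I * (t * a))) + b * (-(Complex.I * (t * b))) + c * 1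
      = c - s * Complex.I := by linear_combination (-Complex.I) * hd
  rw [h0, hp, hm, Matrix.mulVec_smul, Matrix.mulVec_smul, hU, hU, hU, hdp, hdm,
    smul_comm _ r, smul_comm _ r]
  refine ⟨?_, ?_, ?_⟩
  · have hz : (a : ℂ) * (t * b) + b * (-(t * a)) + c * 0 = 0 := by ring
    rw [hz]
    ext i; fin_cases i <;> simp
  · congr 1
    ext i
    fin_cases i <;> simp
    · linear_combination (-Complex.I * t * a) * hsumC
        + 2 * a * (c + s * Complex.I) * hst
        + (-Complex.I * t * a * s ^ 2 - 2 * a * c * s * t) * hI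
    · linear_combination (-Complex.I * t * b) * hsumC
        + 2 * b * (c + s * Complex.I) * hst
        + (-Complex.I * t * b * s ^ 2 - 2 * b * c * s * t) * hI
    · linear_combination hsumC - s ^ 2 * hI
  · congr 1
    ext i
    fin_cases i <;> simp
    · linear_combination (Complex.I * t * a) * hsumC
        + 2 * a * (c - s * Complex.I) * hst
        + (Complex.I * t * a * s ^ 2 - 2 * a * c * s * t) * hI
    · linear_combination (Complex.I * t * b) * hsumC
        + 2 * b * (c - s * Complex.I) * hst
        + (Complex.I * t * b * s ^ 2 - 2 * b * c * s * t) * hI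
    · linear_combination hsumC - s ^ 2 * hI
end

section
/- Let a, b, c be nonnegative reals with a² + b² + c² = 1 and (a,b) ≠ (0,0). In ℂ³ set w = (a,b,c), u = (a,b,0)/√(a²+b²), λ = 2 arccos c, and U = (I − 2 e₃ e₃*)(I − 2 w w*). Then for every natural number p, U^p u = cos(pλ) u + sin(pλ) e₃ and U^p e₃ = −sin(pλ) u + cos(pλ) e₃; that is, U acts on the real plane spanned by u and e₃ as a rotation by angle λ. -/
open Matrix

/-- with `a, b, c ≥ 0`, `a² + b² + c² = 1`, `(a,b) ≠ (0,0)`,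
`w = (a,b,c)`, `u = (a,b,0)/√(a²+b²)`, `λ = 2 arccos c` and
`U = (I − 2 e₃ e₃*)(I − 2 w w*)`, for every natural number `p`:
`U^p u = cos(pλ) u + sin(pλ) e₃` and `U^p e₃ = −sin(pλ) u + cos(pλ) e₃`. -/
theorem stmt_4 (a b c : ℝ) (ha : 0 ≤ a) (hb : 0 ≤ b) (hc : 0 ≤ c)
    (hsum : a ^ 2 + b ^ 2 + c ^ 2 = 1) (hab : ¬(a = 0 ∧ b = 0)) :
    letI U : Matrix (Fin 3) (Fin 3) ℂ :=
      householder ![0, 0, 1] * householder ![(a : ℂ), (b : ℂ), (c : ℂ)]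
    letI u : Fin 3 → ℂ :=
      ((Real.sqrt (a ^ 2 + b ^ 2) : ℂ))⁻¹ • ![(a : ℂ), (b : ℂ), 0]
    letI e₃ : Fin 3 → ℂ := ![0, 0, 1]
    letI lam : ℝ := 2 * Real.arccos c
    ∀ p : ℕ,
      (U ^ p).mulVec u =
          ((Real.cos (p * lam) : ℝ) : ℂ) • u + ((Real.sin (p * lam) : ℝ) : ℂ) • e₃ ∧
        (U ^ p).mulVec e₃ =
          -(((Real.sin (p * lam) : ℝ) : ℂ)) • u + ((Real.cos (p * lam) : ℝ) : ℂ) • e₃ := by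
  intro p
  have hpos : 0 < a ^ 2 + b ^ 2 := by
    rcases not_and_or.mp hab with h | h
    · have := sq_nonneg b
      positivity
    · have := sq_nonneg a
      positivity
  have hs2 : Real.sqrt (a ^ 2 + b ^ 2) ^ 2 = a ^ 2 + b ^ 2 := Real.sq_sqrt hpos.le
  have hspos : 0 < Real.sqrt (a ^ 2 + b ^ 2) := Real.sqrt_pos.mpr hpos
  have hcos0 : Real.cos (Real.arccos c) = c := Real.cos_arccos (by linarith) (by nlinarith)
  have hsin0 : Real.sin (Real.arccos c) = Real.sqrt (a ^ 2 + b ^ 2) := by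
    rw [Real.sin_arccos]; congr 1; linarith
  have hcos : Real.cos (2 * Real.arccos c) = 2 * c ^ 2 - 1 := by
    rw [Real.cos_two_mul, hcos0]
  have hsin : Real.sin (2 * Real.arccos c) = 2 * Real.sqrt (a ^ 2 + b ^ 2) * c := by
    rw [Real.sin_two_mul, hcos0, hsin0]
  generalize 2 * Real.arccos c = lam at *
  generalize Real.sqrt (a ^ 2 + b ^ 2) = s at *
  have hsC : (s : ℂ) ≠ 0 := by exact_mod_cast hspos.ne'
  have hs2C : (s : ℂ) ^ 2 = (a : ℂ) ^ 2 + (b : ℂ) ^ 2 := by exact_mod_cast hs2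
  have hsumC : (a : ℂ) ^ 2 + (b : ℂ) ^ 2 + (c : ℂ) ^ 2 = 1 := by exact_mod_cast hsum
  have hR : ∀ v x : Fin 3 → ℂ, householder v *ᵥ x = x - (2 * (star v ⬝ᵥ x)) • v := by
    intro v x
    ext i
    simp [householder, Matrix.sub_mulVec, Matrix.smul_mulVec, Matrix.vecMulVec_mulVec]
    ring
  have h1 : (householder ![0, 0, 1] * householder ![(a : ℂ), (b : ℂ), (c : ℂ)]) *ᵥ
      ((s : ℂ)⁻¹ • ![(a : ℂ), (b : ℂ), 0]) =
      ((Real.cos lam : ℝ) : ℂ) • ((s : ℂ)⁻¹ • ![(a : ℂ), (b : ℂ), 0])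
        + ((Real.sin lam : ℝ) : ℂ) • ![0, 0, 1] := by
    have hd : star ![(a : ℂ), (b : ℂ), (c : ℂ)] ⬝ᵥ ((s : ℂ)⁻¹ • ![(a : ℂ), (b : ℂ), 0]) = s := by
      simp [dotProduct, Fin.sum_univ_three]
      field_simp
      linear_combination -hs2C
    rw [← Matrix.mulVec_mulVec, hR ![(a : ℂ), (b : ℂ), (c : ℂ)], hd, hR, hcos, hsin]
    ext i
    fin_cases i <;> simp [dotProduct, Fin.sum_univ_three] <;> field_simp
    · linear_combination (-2 * (a : ℂ)) * hs2C - 2 * a * hsumC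
    · linear_combination (-2 * (b : ℂ)) * hs2C - 2 * b * hsumC
    · ring
  have h2 : (householder ![0, 0, 1] * householder ![(a : ℂ), (b : ℂ), (c : ℂ)]) *ᵥ
      ![0, 0, 1] =
      -((Real.sin lam : ℝ) : ℂ) • ((s : ℂ)⁻¹ • ![(a : ℂ), (b : ℂ), 0])
        + ((Real.cos lam : ℝ) : ℂ) • ![0, 0, 1] := by
    rw [← Matrix.mulVec_mulVec, hR ![(a : ℂ), (b : ℂ), (c : ℂ)], hR, hcos, hsin]
    ext i
    fin_cases i <;> simp [dotProduct, Fin.sum_univ_three] <;> field_simp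
    ring
  generalize (householder ![0, 0, 1] * householder ![(a : ℂ), (b : ℂ), (c : ℂ)]) = U at *
  generalize ((s : ℂ)⁻¹ • ![(a : ℂ), (b : ℂ), 0]) = u at *
  generalize (![0, 0, 1] : Fin 3 → ℂ) = e at *
  clear hcos hsin
  induction p with
  | zero => simp
  | succ k ih =>
    obtain ⟨i1, i2⟩ := ih
    have e1 : ((k + 1 : ℕ) : ℝ) * lam = k * lam + lam := by push_cast; ring
    rw [e1, Real.cos_add, Real.sin_add, pow_succ, ← Matrix.mulVec_mulVec,
      ← Matrix.mulVec_mulVec, h1, h2]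
    simp only [Matrix.mulVec_add, Matrix.mulVec_smul, i1, i2]
    constructor <;> (ext i; simp; ring)
end

section
/- Let a, b, c be nonnegative reals with a² + b² + c² = 1 and (a,b) ≠ (0,0). In ℂ³ set w = (a,b,c), u = (a,b,0)/√(a²+b²), λ = 2 arccos c, and U = (I − 2 e₃ e₃*)(I − 2 w w*). If m is a natural number with m·λ = π, then U^m = I − 2 u u* − 2 e₃ e₃*; in particular U^m acts as the Householder reflection I − 2 u u* on the orthogonal complement of e₃ and sends e₃ to −e₃. -/
open Matrix

/-- The rotation with cosine `C` and sine `S` in the plane spanned by `(p,q,0)` and `e₃`. -/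
noncomputable def rotM (p q C S : ℝ) : Matrix (Fin 3) (Fin 3) ℂ :=
  !![1 + ((C : ℂ) - 1) * p ^ 2, ((C : ℂ) - 1) * (p * q), -(S : ℂ) * p;
     ((C : ℂ) - 1) * (p * q), 1 + ((C : ℂ) - 1) * q ^ 2, -(S : ℂ) * q;
     (S : ℂ) * p, (S : ℂ) * q, (C : ℂ)]

lemma proj_apply (v : Fin 3 → ℂ) (i j : Fin 3) :
    ((2 : ℂ) • Matrix.vecMulVec v (star v)) i j = 2 * (v i * star (v j)) := rfl

lemma rotM_mul (p q C S C' S' : ℝ) (h : p ^ 2 + q ^ 2 = 1) :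
    rotM p q C S * rotM p q C' S' = rotM p q (C * C' - S * S') (S * C' + C * S') := by
  have h' : (q : ℂ) ^ 2 = 1 - (p : ℂ) ^ 2 := by
    have : ((p ^ 2 + q ^ 2 : ℝ) : ℂ) = 1 := by rw [h]; simp
    push_cast at this
    linear_combination this
  ext i j
  fin_cases i <;> fin_cases j <;>
    simp [rotM, Matrix.mul_apply, Fin.sum_univ_three] <;> ring_nf <;>
    simp only [h', show (q : ℂ) ^ 3 = q * (1 - (p : ℂ) ^ 2) by rw [← h']; ring,
      show (q : ℂ) ^ 4 = (1 - (p : ℂ) ^ 2) ^ 2 by rw [← h']; ring] <;> ring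

lemma rotM_pow (p q t : ℝ) (h : p ^ 2 + q ^ 2 = 1) (n : ℕ) :
    rotM p q (Real.cos t) (Real.sin t) ^ n = rotM p q (Real.cos (n * t)) (Real.sin (n * t)) := by
  induction n with
  | zero =>
    ext i j
    fin_cases i <;> fin_cases j <;> simp [rotM]
  | succ k ih =>
    rw [pow_succ, ih, rotM_mul _ _ _ _ _ _ h, ← Real.cos_add, ← Real.sin_add]
    push_cast
    rw [show (k : ℝ) * t + t = (k + 1) * t by ring]

/-- with `a, b, c ≥ 0`, `a² + b² + c² = 1`, `(a,b) ≠ (0,0)`,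
`w = (a,b,c)`, `u = (a,b,0)/√(a²+b²)`, `λ = 2 arccos c` and
`U = (I − 2 e₃ e₃*)(I − 2 w w*)`: if `m` is a natural number with `m·λ = π`, then
`U^m = I − 2 u u* − 2 e₃ e₃*`. -/
theorem stmt_5 (a b c : ℝ) (ha : 0 ≤ a) (hb : 0 ≤ b) (hc : 0 ≤ c)
    (hsum : a ^ 2 + b ^ 2 + c ^ 2 = 1) (hab : ¬(a = 0 ∧ b = 0))
    (m : ℕ) (hm : (m : ℝ) * (2 * Real.arccos c) = Real.pi) :
    letI U : Matrix (Fin 3) (Fin 3) ℂ :=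
      householder ![0, 0, 1] * householder ![(a : ℂ), (b : ℂ), (c : ℂ)]
    letI u : Fin 3 → ℂ :=
      ((Real.sqrt (a ^ 2 + b ^ 2) : ℂ))⁻¹ • ![(a : ℂ), (b : ℂ), 0]
    letI e₃ : Fin 3 → ℂ := ![0, 0, 1]
    U ^ m =
      1 - (2 : ℂ) • Matrix.vecMulVec u (star u) - (2 : ℂ) • Matrix.vecMulVec e₃ (star e₃) := by
  have hpos : 0 < a ^ 2 + b ^ 2 := by
    rcases lt_or_eq_of_le (by positivity : 0 ≤ a ^ 2 + b ^ 2) with h | h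
    · exact h
    · exact absurd ⟨by nlinarith, by nlinarith⟩ hab
  obtain ⟨s, hs⟩ : ∃ s, s = Real.sqrt (a ^ 2 + b ^ 2) := ⟨_, rfl⟩
  have hs0 : 0 < s := hs ▸ Real.sqrt_pos.2 hpos
  have hs2 : s ^ 2 = a ^ 2 + b ^ 2 := by rw [hs, Real.sq_sqrt hpos.le]
  obtain ⟨p, hp⟩ : ∃ p, p = s⁻¹ * a := ⟨_, rfl⟩
  obtain ⟨q, hq⟩ : ∃ q, q = s⁻¹ * b := ⟨_, rfl⟩
  have hap : a = s * p := by rw [hp]; field_simp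
  have hbq : b = s * q := by rw [hq]; field_simp
  have hpq : p ^ 2 + q ^ 2 = 1 := by
    rw [hp, hq]; field_simp; linarith
  have hsc : s ^ 2 = 1 - c ^ 2 := by linarith
  have hc1 : c ≤ 1 := by nlinarith
  have hcos : Real.cos (2 * Real.arccos c) = 1 - 2 * s ^ 2 := by
    rw [Real.cos_two_mul, Real.cos_arccos (by linarith) hc1]; linarith
  have hsin : Real.sin (2 * Real.arccos c) = 2 * s * c := by
    rw [Real.sin_two_mul, Real.cos_arccos (by linarith) hc1, Real.sin_arccos, ← hsc,
      Real.sqrt_sq hs0.le]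
  have hscC : (s : ℂ) ^ 2 = 1 - (c : ℂ) ^ 2 := by exact_mod_cast hsc
  have hU : householder ![0, 0, 1] * householder ![(a : ℂ), (b : ℂ), (c : ℂ)] =
      rotM p q (Real.cos (2 * Real.arccos c)) (Real.sin (2 * Real.arccos c)) := by
    rw [hcos, hsin]
    ext i j
    fin_cases i <;> fin_cases j <;>
      simp [-Matrix.cons_vecMulVec, -Matrix.smul_apply, rotM, householder, Matrix.mul_apply,
        Fin.sum_univ_three, proj_apply,
        hap, hbq, Matrix.one_apply] <;> first | ring1 | linear_combination (-2 : ℂ) * hscC | linear_combination (2 : ℂ) * hscC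
  have hu : ((Real.sqrt (a ^ 2 + b ^ 2) : ℂ))⁻¹ • ![(a : ℂ), (b : ℂ), 0] =
      ![(p : ℂ), (q : ℂ), 0] := by
    ext i
    fin_cases i <;> simp [← hs, hp, hq]
  rw [hU, rotM_pow _ _ _ hpq, hm, Real.cos_pi, Real.sin_pi, hu]
  ext i j
  fin_cases i <;> fin_cases j <;>
    simp [-Matrix.cons_vecMulVec, -Matrix.smul_apply, rotM, proj_apply, Matrix.one_apply] <;> ring
end

section
/- Let a, b, c be reals with a, b ≥ 0, 0 < c < 1, a² + b² + c² = 1 and (a,b) ≠ (0,0). In ℂ³ set w = (a,b,c), R = I − 2 e₃ e₃*, and for real θ define F(θ) = I + (e^{iθ} − 1) w w*. Let λ = 2 arccos c. Then for every real θ, the unitary U(θ) = R F(−θ) R F(θ) has spectrum {1, e^{iμ}, e^{−iμ}}, where μ = 2 arcsin( sin(θ/2)·sin λ ) and sin λ = 2c√(1−c²). -/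
open Matrix

/-- The relative phase shift `F(θ) = I + (e^{iθ} − 1) w w*` on the component along `w`. -/
noncomputable def phaseShift (w : Fin 3 → ℂ) (θ : ℝ) : Matrix (Fin 3) (Fin 3) ℂ :=
  1 + (Complex.exp (Complex.I * θ) - 1) • Matrix.vecMulVec w (star w)

lemma det_aux (a b c : ℂ) (ee ff y : ℂ) :
    Matrix.det (!![y, 0, 0; 0, y, 0; 0, 0, y] -
      (ff • !![a*a, a*b, -(a*c); a*b, b*b, -(b*c); -(a*c), -(b*c), c*c]
        + ee • !![a*a, a*b, a*c; a*b, b*b, b*c; a*c, b*c, c*c]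
        + (ee * ff * (a^2+b^2-c^2)) •
            !![a*a, a*b, a*c; a*b, b*b, b*c; -(a*c), -(b*c), -(c*c)])) =
      y * (y^2 - y * ((ee + ff) * (a^2+b^2+c^2) + ee * ff * (a^2+b^2-c^2)^2)
        + ee * ff * ((a^2+b^2+c^2)^2 - (a^2+b^2-c^2)^2)) := by
  rw [Matrix.det_fin_three]
  simp
  ring

lemma house_aux : householder ![0, 0, 1] = !![1, 0, 0; 0, 1, 0; 0, 0, -1] := by
  unfold householder
  ext i j
  rw [Matrix.sub_apply, Matrix.smul_apply, Matrix.vecMulVec_apply, Pi.star_apply]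
  fin_cases i <;> fin_cases j <;> simp [Matrix.vecMulVec_apply, Matrix.one_apply]
  norm_num

lemma phase_aux (a b c θ : ℝ) : phaseShift ![(a : ℂ), (b : ℂ), (c : ℂ)] θ =
    !![1 + (Complex.exp (Complex.I * θ) - 1) * (a * a), (Complex.exp (Complex.I * θ) - 1) * (a * b),
        (Complex.exp (Complex.I * θ) - 1) * (a * c);
      (Complex.exp (Complex.I * θ) - 1) * (a * b), 1 + (Complex.exp (Complex.I * θ) - 1) * (b * b),
        (Complex.exp (Complex.I * θ) - 1) * (b * c);
      (Complex.exp (Complex.I * θ) - 1) * (a * c), (Complex.exp (Complex.I * θ) - 1) * (b * c),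
        1 + (Complex.exp (Complex.I * θ) - 1) * (c * c)] := by
  unfold phaseShift
  generalize Complex.exp (Complex.I * θ) - 1 = e
  ext i j
  rw [Matrix.add_apply, Matrix.smul_apply, Matrix.vecMulVec_apply, Pi.star_apply]
  fin_cases i <;> fin_cases j <;>
    simp [Matrix.vecMulVec_apply, Matrix.one_apply, mul_comm]

lemma mat_aux (a b c : ℝ) (θ : ℝ) (z : ℂ) :
    algebraMap ℂ (Matrix (Fin 3) (Fin 3) ℂ) z -
      (householder ![0, 0, 1] * phaseShift ![(a : ℂ), (b : ℂ), (c : ℂ)] (-θ) *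
        householder ![0, 0, 1] * phaseShift ![(a : ℂ), (b : ℂ), (c : ℂ)] θ) =
    (!![z-1, 0, 0; 0, z-1, 0; 0, 0, z-1] -
      ((Complex.exp (Complex.I * (-θ : ℝ)) - 1) • !![(a:ℂ)*a, a*b, -(a*c); (a:ℂ)*b, b*b, -(b*c); -((a:ℂ)*c), -((b:ℂ)*c), (c:ℂ)*c]
        + (Complex.exp (Complex.I * θ) - 1) • !![(a:ℂ)*a, a*b, a*c; (a:ℂ)*b, b*b, b*c; (a:ℂ)*c, b*c, c*c]
        + ((Complex.exp (Complex.I * θ) - 1) * (Complex.exp (Complex.I * (-θ : ℝ)) - 1) * ((a:ℂ)^2+b^2-c^2)) •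
            !![(a:ℂ)*a, a*b, a*c; (a:ℂ)*b, b*b, b*c; -((a:ℂ)*c), -((b:ℂ)*c), -((c:ℂ)*c)])) := by
  rw [house_aux, phase_aux, phase_aux]
  generalize Complex.exp (Complex.I * (-θ : ℝ)) - 1 = f
  generalize Complex.exp (Complex.I * (θ : ℝ)) - 1 = e
  have hz : algebraMap ℂ (Matrix (Fin 3) (Fin 3) ℂ) z = !![z, 0, 0; 0, z, 0; 0, 0, z] := by
    ext i j
    fin_cases i <;> fin_cases j <;> simp [Matrix.algebraMap_matrix_apply]
  rw [hz]
  ext i j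
  fin_cases i <;> fin_cases j <;>
    simp [Matrix.mul_apply, Fin.sum_univ_three] <;> ring

/-- with `a, b ≥ 0`, `0 < c < 1`, `a² + b² + c² = 1`, `(a,b) ≠ (0,0)`,
`w = (a,b,c)`, `R = I − 2 e₃ e₃*`, `λ = 2 arccos c`, for every real `θ` the unitary
`U(θ) = R F(−θ) R F(θ)` has spectrum `{1, e^{iμ}, e^{−iμ}}` where
`μ = 2 arcsin(sin(θ/2)·sin λ)`, and `sin λ = 2c√(1−c²)`. -/
theorem stmt_6 (a b c : ℝ) (ha : 0 ≤ a) (hb : 0 ≤ b) (hc0 : 0 < c) (hc1 : c < 1)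
    (hsum : a ^ 2 + b ^ 2 + c ^ 2 = 1) (hab : ¬(a = 0 ∧ b = 0)) :
    letI w : Fin 3 → ℂ := ![(a : ℂ), (b : ℂ), (c : ℂ)]
    letI R : Matrix (Fin 3) (Fin 3) ℂ := householder ![0, 0, 1]
    letI lam : ℝ := 2 * Real.arccos c
    (∀ θ : ℝ,
        letI μ : ℝ := 2 * Real.arcsin (Real.sin (θ / 2) * Real.sin lam)
        spectrum ℂ (R * phaseShift w (-θ) * R * phaseShift w θ) =
          {1, Complex.exp (Complex.I * μ), Complex.exp (-(Complex.I * μ))}) ∧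
      Real.sin lam = 2 * c * Real.sqrt (1 - c ^ 2) := by
  have hsin : Real.sin (2 * Real.arccos c) = 2 * c * Real.sqrt (1 - c ^ 2) := by
    rw [Real.sin_two_mul, Real.sin_arccos, Real.cos_arccos (by linarith) (by linarith)]
    ring
  refine ⟨fun θ => ?_, hsin⟩
  have hS1 : -1 ≤ Real.sin (θ / 2) * Real.sin (2 * Real.arccos c) := by
    have h := abs_mul (Real.sin (θ / 2)) (Real.sin (2 * Real.arccos c))
    have h2 := mul_le_one₀ (Real.abs_sin_le_one (θ / 2)) (abs_nonneg _)
      (Real.abs_sin_le_one (2 * Real.arccos c))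
    exact (abs_le.1 (h.trans_le h2)).1
  have hS2 : Real.sin (θ / 2) * Real.sin (2 * Real.arccos c) ≤ 1 := by
    have h := abs_mul (Real.sin (θ / 2)) (Real.sin (2 * Real.arccos c))
    have h2 := mul_le_one₀ (Real.abs_sin_le_one (θ / 2)) (abs_nonneg _)
      (Real.abs_sin_le_one (2 * Real.arccos c))
    exact (abs_le.1 (h.trans_le h2)).2
  have hsq : Real.sqrt (1 - c ^ 2) ^ 2 = 1 - c ^ 2 := Real.sq_sqrt (by nlinarith)
  have hcosμ : 2 * Real.cos (2 * Real.arcsin (Real.sin (θ / 2) * Real.sin (2 * Real.arccos c))) =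
      2 - (2 - 2 * Real.cos θ) * (1 - (a ^ 2 + b ^ 2 - c ^ 2) ^ 2) := by
    have hg : a ^ 2 + b ^ 2 - c ^ 2 = 1 - 2 * c ^ 2 := by linarith
    have hθ : Real.cos θ = 1 - 2 * Real.sin (θ / 2) ^ 2 := by
      have := Real.cos_two_mul (θ / 2)
      rw [show 2 * (θ / 2) = θ by ring] at this
      have h2 := Real.sin_sq_add_cos_sq (θ / 2)
      linarith
    rw [Real.cos_two_mul, Real.cos_sq', Real.sin_arcsin hS1 hS2, hsin, hg, hθ]
    linear_combination (-16 * Real.sin (θ / 2) ^ 2 * c ^ 2) * hsq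
  generalize 2 * Real.arcsin (Real.sin (θ / 2) * Real.sin (2 * Real.arccos c)) = μ at hcosμ
  have key : ∀ t : ℝ, Complex.exp (Complex.I * t) + Complex.exp (-(Complex.I * t))
      = ((2 * Real.cos t : ℝ) : ℂ) := by
    intro t
    push_cast
    rw [Complex.two_cos]
    ring_nf
  have hprod : ∀ t : ℝ, Complex.exp (Complex.I * t) * Complex.exp (-(Complex.I * t)) = 1 := by
    intro t
    rw [← Complex.exp_add]; simp
  have h1 := key μ
  rw [hcosμ] at h1
  have h2 := hprod μ
  have h3 := key θ
  have h4 := hprod θ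
  have hN : (a : ℂ) ^ 2 + b ^ 2 + c ^ 2 = 1 := by exact_mod_cast hsum
  ext z
  rw [spectrum.mem_iff, mat_aux, Matrix.isUnit_iff_isUnit_det, det_aux, isUnit_iff_ne_zero, not_not]
  rw [show Complex.I * ((-θ : ℝ) : ℂ) = -(Complex.I * θ) by push_cast; ring, hN]
  generalize Complex.exp (-(Complex.I * θ)) = f at *
  generalize Complex.exp (Complex.I * θ) = e at *
  generalize Complex.exp (-(Complex.I * μ)) = F at *
  generalize Complex.exp (Complex.I * μ) = E at *
  push_cast at h1 h3
  generalize (a : ℂ) ^ 2 + b ^ 2 - c ^ 2 = g at *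
  rw [← h3] at h1
  have hfac : (z - 1) * ((z - 1) ^ 2 - (z - 1) * ((e - 1 + (f - 1)) * 1 + (e - 1) * (f - 1) * g ^ 2)
      + (e - 1) * (f - 1) * (1 ^ 2 - g ^ 2)) = (z - 1) * ((z - E) * (z - F)) := by
    have hF : F = 2 - (2 - (e + f)) * (1 - g ^ 2) - E := by linear_combination h1
    linear_combination (z - 1) * z * h1 - (z - 1) * h2 + (z - 1) * (1 - g ^ 2 - (z - 1) * g ^ 2) * h4
  rw [hfac]
  simp [sub_eq_zero]
end

section
/- Let S be a nonempty finite set of positive integers. Define Λ₀(S) = S and, recursively for k ≥ 1, Λ_k(S) = {λ ∈ Λ_{k−1}(S) : 2·gcd(Λ_{k−1}(S)) divides λ} whenever Λ_{k−1}(S) is nonempty. Then the least d with Λ_d(S) = ∅ equals the number of distinct values taken by the 2-adic valuation v₂ on the elements of S. -/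
/-- The recursive subdivision of a set of positive integers:
`Λ₀(S) = S` and `Λ_k(S) = {λ ∈ Λ_{k−1}(S) : 2·gcd(Λ_{k−1}(S)) ∣ λ}`. -/
def Lam (S : Finset ℕ) : ℕ → Finset ℕ
  | 0 => S
  | k + 1 => (Lam S k).filter fun lam => 2 * (Lam S k).gcd id ∣ lam

theorem step_aux (T : Finset ℕ) (hT : T.Nonempty) (hpos : ∀ m ∈ T, 0 < m) :
    ((T.filter fun l => 2 * T.gcd id ∣ l).image fun m => m.factorization 2).card + 1
      = (T.image fun m => m.factorization 2).card := by
  obtain ⟨a, ha, hmin⟩ := T.exists_min_image (fun m => m.factorization 2) hT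
  have hgd : ∀ m ∈ T, T.gcd id ∣ m := fun m hm => Finset.gcd_dvd (f := id) hm
  have hg0 : T.gcd id ≠ 0 := by
    intro h
    have h1 := hgd a ha
    rw [h, zero_dvd_iff] at h1
    exact absurd (hpos a ha) (by omega)
  have hpow : 2 ^ a.factorization 2 ∣ T.gcd id := by
    refine Finset.dvd_gcd fun m hm => ?_
    exact (Nat.Prime.pow_dvd_iff_le_factorization Nat.prime_two (hpos m hm).ne').2 (hmin m hm)
  have hge := (Nat.Prime.pow_dvd_iff_le_factorization Nat.prime_two hg0).1 hpow
  have hle : (T.gcd id).factorization 2 ≤ a.factorization 2 :=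
    (Nat.factorization_le_iff_dvd hg0 (hpos a ha).ne').2 (hgd a ha) 2
  have key : ∀ m ∈ T, (2 * T.gcd id ∣ m ↔ m.factorization 2 ≠ a.factorization 2) := by
    intro m hm
    obtain ⟨q, hq⟩ := hgd m hm
    have hq0 : q ≠ 0 := by
      rintro rfl
      have := hpos m hm
      simp at hq
      omega
    have hf : m.factorization 2 = (T.gcd id).factorization 2 + q.factorization 2 := by
      conv_lhs => rw [hq]
      rw [Nat.factorization_mul hg0 hq0]; rfl
    have h2 : 2 * T.gcd id ∣ m ↔ 2 ∣ q := by
      conv_lhs => rw [hq, mul_comm 2]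
      exact Nat.mul_dvd_mul_iff_left (Nat.pos_of_ne_zero hg0)
    have h3 := Nat.Prime.pow_dvd_iff_le_factorization Nat.prime_two (k := 1) hq0
    rw [pow_one] at h3
    rw [h2, h3]
    omega
  have himg : ((T.filter fun l => 2 * T.gcd id ∣ l).image fun m => m.factorization 2)
      = (T.image fun m => m.factorization 2).erase (a.factorization 2) := by
    ext v
    simp only [Finset.mem_image, Finset.mem_filter, Finset.mem_erase]
    constructor
    · rintro ⟨m, ⟨hm, hd⟩, rfl⟩
      exact ⟨(key m hm).1 hd, m, hm, rfl⟩
    · rintro ⟨hne, m, hm, rfl⟩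
      exact ⟨m, ⟨hm, (key m hm).2 hne⟩, rfl⟩
  rw [himg]
  exact Finset.card_erase_add_one (Finset.mem_image_of_mem _ ha)

theorem Lam_subset_aux (S : Finset ℕ) (k : ℕ) : Lam S k ⊆ S := by
  induction k with
  | zero => exact Finset.Subset.refl _
  | succ k ih => exact (Finset.filter_subset _ _).trans ih

theorem card_aux (S : Finset ℕ) (hpos : ∀ m ∈ S, 0 < m) (k : ℕ) :
    ((Lam S k).image fun m => m.factorization 2).card
      = (S.image fun m => m.factorization 2).card - k := by
  induction k with
  | zero => rfl
  | succ k ih =>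
    rcases (Lam S k).eq_empty_or_nonempty with h | h
    · have h1 : Lam S (k + 1) = ∅ := by simp [Lam, h]
      rw [h] at ih
      rw [h1]
      simp only [Finset.image_empty, Finset.card_empty] at ih ⊢
      omega
    · have h1 := step_aux (Lam S k) h fun m hm => hpos m (Lam_subset_aux S k hm)
      rw [ih] at h1
      simp only [Lam]
      omega

/-- for a nonempty finite set `S` of positive integers, the least `d` with
`Λ_d(S) = ∅` equals the number of distinct values taken by the 2-adic valuation `v₂` on
the elements of `S`. -/
theorem stmt_9 (S : Finset ℕ) (hS : S.Nonempty) (hpos : ∀ m ∈ S, 0 < m) :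
    sInf {d : ℕ | Lam S d = ∅} = (S.image fun m => m.factorization 2).card := by
  have h : {d : ℕ | Lam S d = ∅} = Set.Ici (S.image fun m => m.factorization 2).card := by
    ext d
    have h1 := card_aux S hpos d
    rw [Set.mem_setOf_eq, Set.mem_Ici, ← Nat.sub_eq_zero_iff_le, ← h1, Finset.card_eq_zero,
      Finset.image_eq_empty]
  rw [h]
  exact csInf_Ici
end

section
/- Let n ≥ 1 and let S = {2, 4, 6, …, 2n} be the set of nonzero Laplacian eigenvalues of the n-dimensional hypercube. Define Λ₀(S) = S and, recursively for k ≥ 1, Λ_k(S) = {λ ∈ Λ_{k−1}(S) : 2·gcd(Λ_{k−1}(S)) divides λ} whenever Λ_{k−1}(S) is nonempty. Then the least d with Λ_d(S) = ∅ equals ⌈log₂(n+1)⌉. -/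
theorem mem_Lam_cube (n k x : ℕ) :
    x ∈ Lam ((Finset.Icc 1 n).image fun k => 2 * k) k ↔
      1 ≤ x ∧ x ≤ 2 * n ∧ 2 ^ (k + 1) ∣ x := by
  induction k generalizing x with
  | zero =>
    simp only [Lam, Finset.mem_image, Finset.mem_Icc]
    constructor
    · rintro ⟨a, ha, rfl⟩
      exact ⟨by omega, by omega, by simp⟩
    · rintro ⟨h1, h2, h3⟩
      obtain ⟨c, rfl⟩ := h3
      exact ⟨c, by omega, by omega⟩
  | succ k ih =>
    simp only [Lam, Finset.mem_filter]
    have key : x ∈ Lam ((Finset.Icc 1 n).image fun k => 2 * k) k →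
        (Lam ((Finset.Icc 1 n).image fun k => 2 * k) k).gcd id = 2 ^ (k + 1) := by
      intro hx
      apply Nat.dvd_antisymm
      · have hm : 2 ^ (k + 1) ∈ Lam ((Finset.Icc 1 n).image fun k => 2 * k) k := by
          rw [ih] at hx ⊢
          exact ⟨Nat.one_le_two_pow, (Nat.le_of_dvd hx.1 hx.2.2).trans hx.2.1, dvd_rfl⟩
        simpa using Finset.gcd_dvd (f := id) hm
      · apply Finset.dvd_gcd
        intro b hb
        exact ((ih b).1 hb).2.2
    constructor
    · rintro ⟨h1, h2⟩
      rw [key h1] at h2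
      rw [ih] at h1
      refine ⟨h1.1, h1.2.1, ?_⟩
      rwa [pow_succ']
    · rintro ⟨h1, h2, h3⟩
      have h : x ∈ Lam ((Finset.Icc 1 n).image fun k => 2 * k) k :=
        (ih x).2 ⟨h1, h2, (pow_dvd_pow 2 (by omega)).trans h3⟩
      refine ⟨h, ?_⟩
      rw [key h, ← pow_succ']
      exact h3

theorem Lam_cube_empty (n k : ℕ) :
    Lam ((Finset.Icc 1 n).image fun k => 2 * k) k = ∅ ↔ Nat.clog 2 (n + 1) ≤ k := by
  rw [Nat.clog_le_iff_le_pow (by norm_num), Finset.eq_empty_iff_forall_notMem]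
  constructor
  · intro h
    by_contra hc
    refine h (2 ^ (k + 1)) ((mem_Lam_cube n k _).2 ⟨Nat.one_le_two_pow, ?_, dvd_rfl⟩)
    rw [pow_succ]
    omega
  · intro h x hx
    rw [mem_Lam_cube] at hx
    have := Nat.le_of_dvd hx.1 hx.2.2
    rw [pow_succ] at this
    omega

/-- for `S = {2, 4, …, 2n}`, the set of nonzero Laplacian eigenvalues of
the `n`-dimensional hypercube (`n ≥ 1`), the least `d` with `Λ_d(S) = ∅` equals
`⌈log₂(n+1)⌉`. -/
theorem stmt_10 (n : ℕ) (hn : 1 ≤ n) :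
    sInf {d : ℕ | Lam ((Finset.Icc 1 n).image fun k => 2 * k) d = ∅} =
      Nat.clog 2 (n + 1) := by
  simp only [Lam_cube_empty]
  exact csInf_Ici
end

section
/- Fix an integer d ≥ 1. For real N > 1 define p(N) = π / (2 arccos √(1 − N^{−1/d})) and N_iter(N) = (1/2)(p(N)^d − 1). Then lim_{N→∞} N_iter(N)/√N = (1/2)(π/2)^d. -/
open Real Filter

lemma aux_arcsin : Tendsto (fun s : ℝ => s / Real.arcsin s) (nhdsWithin 0 {0}ᶜ) (nhds 1) := by
  have h := Real.hasDerivAt_arcsin (x := 0) (by norm_num) (by norm_num)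
  rw [hasDerivAt_iff_tendsto_slope] at h
  have h2 := h.inv₀ (by norm_num)
  norm_num at h2
  refine h2.congr fun s => ?_
  simp [slope_def_field]

/-- fix `d ≥ 1`; with `p(N) = π/(2 arccos √(1 − N^{−1/d}))` and
`N_iter(N) = (1/2)(p(N)^d − 1)`, we have `lim_{N→∞} N_iter(N)/√N = (1/2)(π/2)^d`. -/
theorem stmt_11 (d : ℕ) (hd : 1 ≤ d) :
    Tendsto
      (fun N : ℝ =>
        ((1 / 2 : ℝ) *
            ((Real.pi / (2 * Real.arccos (Real.sqrt (1 - N ^ (-(1 : ℝ) / d))))) ^ d - 1)) /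
          Real.sqrt N)
      atTop (nhds ((1 / 2) * (Real.pi / 2) ^ d)) := by
  have hd0 : (0 : ℝ) < d := by exact_mod_cast hd
  have hs : Tendsto (fun N : ℝ => N ^ (-(1 / (2 * d) : ℝ))) atTop (nhds 0) :=
    tendsto_rpow_neg_atTop (by positivity)
  have hs' : Tendsto (fun N : ℝ => N ^ (-(1 / (2 * d) : ℝ))) atTop (nhdsWithin 0 {0}ᶜ) := by
    refine tendsto_nhdsWithin_iff.2 ⟨hs, ?_⟩
    filter_upwards [eventually_gt_atTop 0] with N hN
    exact (Real.rpow_pos_of_pos hN _).ne'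
  have h1 := aux_arcsin.comp hs'
  have h2 := (((h1.const_mul (Real.pi / 2)).pow d).sub (hs.pow d)).const_mul (1 / 2 : ℝ)
  have e : (1 / 2 : ℝ) * ((Real.pi / 2 * 1) ^ d - 0 ^ d) = (1 / 2) * (Real.pi / 2) ^ d := by
    rw [zero_pow (by omega)]; ring
  rw [e] at h2
  refine h2.congr' ?_
  filter_upwards [eventually_gt_atTop 0] with N hN
  have hsp := Real.rpow_pos_of_pos hN (-(1 / (2 * d) : ℝ))
  have hsq : N ^ (-(1 : ℝ) / d) = (N ^ (-(1 / (2 * d) : ℝ))) ^ 2 := by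
    rw [← Real.rpow_natCast, ← Real.rpow_mul hN.le]
    congr 1; push_cast; field_simp
  have hsd : (N ^ (-(1 / (2 * d) : ℝ))) ^ d = (Real.sqrt N)⁻¹ := by
    rw [← Real.rpow_natCast, ← Real.rpow_mul hN.le, Real.sqrt_eq_rpow, ← Real.rpow_neg hN.le]
    congr 1; field_simp
  simp only [Function.comp]
  rw [hsq, ← Real.arcsin_eq_arccos hsp.le, div_eq_mul_inv _ (Real.sqrt N), ← hsd]
  generalize N ^ (-(1 / (2 * d) : ℝ)) = s
  rw [mul_assoc, sub_mul, ← mul_pow, one_mul]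
  congr 3
  simp only [div_eq_mul_inv, mul_inv]
  ring
end

section
/- For integers n ≥ 2 define p₁(n) = π / (2 arccos √(1 − 1/n)), p₂(n) = π / (2 arccos √(1 − 1/n³)), and N_iter(n) = (1/2)(p₁(n)·p₂(n) − 1). Then lim_{n→∞} N_iter(n)/n² = π²/8. -/
open Real Filter

theorem aux_key (k : ℕ) (hk : k ≠ 0) :
    Tendsto (fun n : ℕ => √(1 / (n : ℝ) ^ k) / arccos (√(1 - 1 / (n : ℝ) ^ k))) atTop (nhds 1) := by
  have h0 : Tendsto (fun x : ℝ => x⁻¹ * arcsin x) (nhdsWithin 0 {0}ᶜ) (nhds 1) := by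
    have h := hasDerivAt_arcsin (x := 0) (by norm_num) (by norm_num)
    rw [hasDerivAt_iff_tendsto_slope_zero] at h
    simpa using h
  have h1 : Tendsto (fun n : ℕ => √(1 / (n : ℝ) ^ k)) atTop (nhdsWithin 0 {0}ᶜ) := by
    rw [tendsto_nhdsWithin_iff]
    constructor
    · have h2 : Tendsto (fun n : ℕ => 1 / (n : ℝ) ^ k) atTop (nhds 0) := by
        have := ((tendsto_pow_atTop (α := ℝ) hk).comp tendsto_natCast_atTop_atTop).inv_tendsto_atTop
        refine this.congr fun n => ?_
        simp
      have := (Real.continuous_sqrt.tendsto 0).comp h2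
      simpa [Function.comp_def] using this
    · filter_upwards [eventually_gt_atTop 0] with n hn
      have : (0 : ℝ) < n := by exact_mod_cast hn
      have : 0 < √(1 / (n : ℝ) ^ k) := by positivity
      exact this.ne'
  have h3 := (h0.comp h1).inv₀ one_ne_zero
  rw [inv_one] at h3
  refine h3.congr fun n => ?_
  have h4 := arcsin_eq_arccos (Real.sqrt_nonneg (1 / (n : ℝ) ^ k))
  rw [Real.sq_sqrt (by positivity)] at h4
  simp only [Function.comp_def]
  rw [h4, mul_inv, inv_inv, ← div_eq_mul_inv]

/-- with `p₁(n) = π/(2 arccos √(1 − 1/n))`,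
`p₂(n) = π/(2 arccos √(1 − 1/n³))` and `N_iter(n) = (1/2)(p₁(n)p₂(n) − 1)`,
we have `lim_{n→∞} N_iter(n)/n² = π²/8`. -/
theorem stmt_18 :
    Tendsto
      (fun n : ℕ =>
        ((1 / 2 : ℝ) *
            ((Real.pi / (2 * Real.arccos (Real.sqrt (1 - 1 / (n : ℝ))))) *
                (Real.pi / (2 * Real.arccos (Real.sqrt (1 - 1 / (n : ℝ) ^ 3)))) - 1)) /
          (n : ℝ) ^ 2)
      atTop (nhds (Real.pi ^ 2 / 8)) := by
  have h1 := aux_key 1 one_ne_zero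
  have h3 := aux_key 3 (by norm_num)
  have h2 : Tendsto (fun n : ℕ => 1 / (n : ℝ) ^ 2) atTop (nhds 0) := by
    have := ((tendsto_pow_atTop (α := ℝ) two_ne_zero).comp
      tendsto_natCast_atTop_atTop).inv_tendsto_atTop
    refine this.congr fun n => ?_
    simp
  have h := (((h1.mul h3).const_mul (π ^ 2 / 4)).sub h2).const_mul (1 / 2)
  have e : (1 / 2 : ℝ) * (π ^ 2 / 4 * (1 * 1) - 0) = π ^ 2 / 8 := by ring
  rw [e] at h
  refine h.congr fun n => ?_
  have hab : √(1 / (n : ℝ) ^ 1) * √(1 / (n : ℝ) ^ 3) = 1 / (n : ℝ) ^ 2 := by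
    rw [← Real.sqrt_mul (by positivity), show 1 / (n : ℝ) ^ 1 * (1 / (n : ℝ) ^ 3)
      = (1 / (n : ℝ) ^ 2) ^ 2 by ring, Real.sqrt_sq (by positivity)]
  rw [div_mul_div_comm, hab, pow_one]
  ring
end
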